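/- There exists a universal constant c ∈ (0,∞) with the following property. Let n ≥ 3, R > 0, and let X ∈ C²(B,ℝⁿ) ∩ C⁰(B̄,ℝⁿ) be harmonic in B and conformally parametrized (|X_u|² = |X_v|² = W, X_u·X_v = 0, W > 0 in B), such that the plane mapping F*(u,v) := (x¹(u,v), x²(u,v)) formed by its first two components maps B̄ one-to-one onto B̄_R with positive Jacobian in B, satisfies F*(0,0) = (0,0), and maps ∂B topologically onto ∂B_R. Then the area element at the origin satisfies W(0,0) ≥ c·R². -/

import Mathlib

open scoped RealInnerProductSpace

/-- First partial derivative (w.r.t. the first variable `u`). -/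
noncomputable def pd1 {E : Type*} [NormedAddCommGroup E] [NormedSpace ℝ E]
    (f : ℝ × ℝ → E) (p : ℝ × ℝ) : E := fderiv ℝ f p (1, 0)

/-- Second partial derivative (w.r.t. the second variable `v`). -/
noncomputable def pd2 {E : Type*} [NormedAddCommGroup E] [NormedSpace ℝ E]
    (f : ℝ × ℝ → E) (p : ℝ × ℝ) : E := fderiv ℝ f p (0, 1)

/-- The open unit disc `B = {(u,v) : u² + v² < 1}`. -/
def unitB : Set (ℝ × ℝ) := {p | p.1 ^ 2 + p.2 ^ 2 < 1}

/-- The open disc `B_R = {(x,y) : x² + y² < R²}`. -/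
def diskR (R : ℝ) : Set (ℝ × ℝ) := {p | p.1 ^ 2 + p.2 ^ 2 < R ^ 2}

/-- The circle `∂B_R = {(x,y) : x² + y² = R²}`. -/
def circleR (R : ℝ) : Set (ℝ × ℝ) := {p | p.1 ^ 2 + p.2 ^ 2 = R ^ 2}

open Set Real InnerProductSpace Metric

section CircleEstimate

open intervalIntegral

/-- A continuous function without zeros on an open interval has constant sign there. -/
lemma exists_sign_of_ne_zero_on_Ioo {u : ℝ → ℝ} (hc : Continuous u) {a b : ℝ}
    (hne : ∀ t ∈ Ioo a b, u t ≠ 0) :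
    ∃ σ : ℝ, (σ = 1 ∨ σ = -1) ∧ ∀ t ∈ Ioo a b, 0 < σ * u t := by
  by_cases h : ∃ s ∈ Ioo a b, u s < 0
  · obtain ⟨s, hs, hus⟩ := h
    refine ⟨-1, Or.inr rfl, fun t ht => ?_⟩
    by_contra! hcon
    obtain ⟨r, hr, hur⟩ := isPreconnected_Ioo.intermediate_value hs ht hc.continuousOn
      (⟨hus.le, by linarith⟩ : (0 : ℝ) ∈ Icc (u s) (u t))
    exact hne r hr hur
  · push Not at h
    exact ⟨1, Or.inl rfl, fun t ht => by
      simpa using lt_of_le_of_ne (h t ht) (hne t ht).symm⟩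

/-- The integral over a period of the tenth power of `cos ((t - α) / 2)`. -/
lemma integral_half_one_add_cos_pow_five (α : ℝ) :
    ∫ t in α..(α + 2 * π), ((1 + cos (t - α)) / 2) ^ 5 = 2 * π * (63 / 256) := by
  have h := integral_comp_sub_right (a := α) (b := α + 2 * π)
    (fun t => ((1 + cos t) / 2) ^ 5) α
  simp only [sub_self, add_sub_cancel_left] at h
  rw [h]
  have e : ∀ t : ℝ, ((1 + cos t) / 2) ^ 5 = 1 / 32 + 5 / 32 * cos t ^ 1 + 10 / 32 * cos t ^ 2
      + 10 / 32 * cos t ^ 3 + 5 / 32 * cos t ^ 4 + 1 / 32 * cos t ^ 5 := fun t => by ring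
  have i (n : ℕ) (c : ℝ) : IntervalIntegrable (fun t => c * cos t ^ n) MeasureTheory.volume
      0 (2 * π) := Continuous.intervalIntegrable (by fun_prop) _ _
  have i0 : IntervalIntegrable (fun _ : ℝ => (1 / 32 : ℝ)) MeasureTheory.volume
      0 (2 * π) := Continuous.intervalIntegrable (by fun_prop) _ _
  simp_rw [e]
  rw [integral_add ((((i0.add (i _ _)).add (i _ _)).add (i _ _)).add (i _ _)) (i _ _),
    integral_add (((i0.add (i _ _)).add (i _ _)).add (i _ _)) (i _ _),
    integral_add ((i0.add (i _ _)).add (i _ _)) (i _ _),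
    integral_add (i0.add (i _ _)) (i _ _), integral_add i0 (i _ _)]
  simp only [integral_const_mul]
  rw [integral_cos_pow 3, integral_cos_pow 2, integral_cos_pow 1, integral_cos_pow 0]
  simp
  ring

/-- The product of the two half-angle sines dominates a bump function vanishing at their zeros. -/
lemma one_sub_pow_sub_pow_le {s r : ℝ} (hs : s ^ 2 ≤ 1) (hr : r ^ 2 ≤ 1) :
    1 - (1 - s ^ 2) ^ 5 - (1 - r ^ 2) ^ 5 ≤ 25 * |s * r| := by
  have key (x : ℝ) (hx : x ^ 2 ≤ 1) :
      0 ≤ 1 - (1 - x ^ 2) ^ 5 ∧ 1 - (1 - x ^ 2) ^ 5 ≤ 5 * |x| := by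
    have h1 : (1 - x ^ 2) ^ 5 ≤ 1 := pow_le_one₀ (by linarith) (by nlinarith [sq_nonneg x])
    have h2 := one_add_mul_le_pow (a := -x ^ 2) (by linarith) 5
    have h3 : x ^ 2 ≤ |x| := by
      have := abs_le_one_iff_mul_self_le_one.2 (by nlinarith : x * x ≤ 1)
      rw [← sq_abs]; nlinarith [abs_nonneg x]
    refine ⟨by linarith, ?_⟩
    push_cast at h2
    have : (1 + -x ^ 2) ^ 5 = (1 - x ^ 2) ^ 5 := by ring
    linarith
  obtain ⟨a0, a1⟩ := key s hs
  obtain ⟨b0, b1⟩ := key r hr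
  have hm := mul_le_mul a1 b1 b0 (by positivity)
  have hA : 0 ≤ (1 - s ^ 2) ^ 5 := pow_nonneg (by linarith) _
  have hB : 0 ≤ (1 - r ^ 2) ^ 5 := pow_nonneg (by linarith) _
  rw [abs_mul]
  nlinarith [mul_nonneg hA hB]

/-- Quantitative form of Radó's argument: a bounded function on the circle with mean zero and
exactly two zeros has a first Fourier coefficient bounded away from zero. -/
lemma exists_le_abs_integral_mul_cos {u : ℝ → ℝ} (hc : Continuous u)
    (hp : Function.Periodic u (2 * π)) {α β : ℝ} (hαβ : α < β) (hβ : β < α + 2 * π)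
    (huβ : u β = 0) (hne : ∀ t ∈ Ioo α (α + 2 * π), u t = 0 → t = β)
    (hle : ∀ t, u t ^ 2 ≤ 1) (hmean : ∫ t in 0..(2 * π), u t = 0)
    (hsq : π ≤ ∫ t in 0..(2 * π), u t ^ 2) :
    ∃ m, π / 800 ≤ |∫ t in 0..(2 * π), u t * cos (t - m)| := by
  have hpi := pi_pos
  have shift (f : ℝ → ℝ) (hf : Function.Periodic f (2 * π)) :
      ∫ t in 0..(2 * π), f t = ∫ t in α..(α + 2 * π), f t := by
    simpa using hf.intervalIntegral_add_eq 0 α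
  have ii {f : ℝ → ℝ} (hf : Continuous f) :
      IntervalIntegrable f MeasureTheory.volume α (α + 2 * π) := hf.intervalIntegrable _ _
  have hle2 : α ≤ α + 2 * π := by linarith
  rw [shift u hp] at hmean
  rw [shift (fun t => u t ^ 2) (fun t => by simp only [hp t])] at hsq
  have habs : ∀ t, |u t| ≤ 1 := fun t => by
    have := hle t; exact abs_le_one_iff_mul_self_le_one.2 (by nlinarith)
  have hsqabs : ∀ t, u t ^ 2 ≤ |u t| := fun t => by
    rw [← sq_abs]; nlinarith [abs_nonneg (u t), habs t]
  obtain ⟨σ, hσ, h1⟩ := exists_sign_of_ne_zero_on_Ioo hc (a := α) (b := β)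
    (fun t ht h => ht.2.ne (hne t ⟨ht.1, ht.2.trans hβ⟩ h))
  obtain ⟨τ, hτ, h2⟩ := exists_sign_of_ne_zero_on_Ioo hc (a := β) (b := α + 2 * π)
    (fun t ht h => ht.1.ne' (hne t ⟨hαβ.trans ht.1, ht.2⟩ h))
  have absσ : ∀ x, |σ * x| = |x| := fun x => by rcases hσ with rfl | rfl <;> simp
  have hστ : τ = -σ := by
    by_contra hcon
    have hEq : τ = σ := by
      rcases hσ with rfl | rfl <;> rcases hτ with rfl | rfl <;> simp_all
    subst hEq
    have : ∫ t in α..(α + 2 * π), u t ^ 2 ≤ ∫ t in α..(α + 2 * π), τ * u t := by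
      refine integral_mono_on_of_le_Ioo hle2 (ii (by fun_prop)) (ii (by fun_prop))
        fun t ht => ?_
      have hn : 0 ≤ τ * u t := by
        rcases lt_trichotomy t β with h | h | h
        · exact (h1 t ⟨ht.1, h⟩).le
        · simp [h, huβ]
        · exact (h2 t ⟨h, ht.2⟩).le
      rw [← abs_of_nonneg hn, absσ]
      exact hsqabs t
    rw [integral_const_mul, hmean] at this
    linarith
  subst hστ
  refine ⟨(α + β) / 2, ?_⟩
  rw [shift (fun t => u t * cos (t - (α + β) / 2)) (fun t => by
    simp only [hp t, add_sub_right_comm, cos_add_two_pi])]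
  set k := cos ((α - β) / 2) with hk
  have hL : ∀ t, cos (t - (α + β) / 2) - k = -2 * sin ((t - α) / 2) * sin ((t - β) / 2) := by
    intro t
    rw [hk, cos_sub_cos]
    ring_nf
  have hsub : ∫ t in α..(α + 2 * π), u t * cos (t - (α + β) / 2) =
      ∫ t in α..(α + 2 * π), u t * (-2 * sin ((t - α) / 2) * sin ((t - β) / 2)) := by
    simp_rw [← hL, mul_sub]
    rw [integral_sub (ii (by fun_prop)) (ii (by fun_prop)), integral_mul_const, hmean]
    simp
  have hpow (t a : ℝ) : ((1 + cos (t - a)) / 2) ^ 5 = (1 - sin ((t - a) / 2) ^ 2) ^ 5 := by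
    rw [← cos_sq', cos_sq]
    ring_nf
  have hmono : ∫ t in α..(α + 2 * π), (2 / 25) * (u t ^ 2 -
        (((1 + cos (t - α)) / 2) ^ 5 + ((1 + cos (t - β)) / 2) ^ 5)) ≤
      ∫ t in α..(α + 2 * π), σ * (u t * (-2 * sin ((t - α) / 2) * sin ((t - β) / 2))) := by
    refine integral_mono_on_of_le_Ioo hle2 (ii (by fun_prop)) (ii (by fun_prop))
      fun t ht => ?_
    have hs1 : 0 < sin ((t - α) / 2) :=
      sin_pos_of_pos_of_lt_pi (by linarith [ht.1]) (by linarith [ht.2])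
    have hn : 0 ≤ σ * (u t * (-2 * sin ((t - α) / 2) * sin ((t - β) / 2))) := by
      rcases lt_trichotomy t β with h | h | h
      · have hs2 : sin ((t - β) / 2) < 0 :=
          sin_neg_of_neg_of_neg_pi_lt (by linarith) (by linarith [ht.1])
        have := mul_pos (h1 t ⟨ht.1, h⟩) (mul_pos hs1 (neg_pos.2 hs2))
        nlinarith
      · simp [h, huβ]
      · have hs2 : 0 < sin ((t - β) / 2) :=
          sin_pos_of_pos_of_lt_pi (by linarith) (by linarith [ht.2])
        have := mul_pos (h2 t ⟨h, ht.2⟩) (mul_pos hs1 hs2)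
        nlinarith
    have key := one_sub_pow_sub_pow_le (sin_sq_le_one ((t - α) / 2)) (sin_sq_le_one ((t - β) / 2))
    rw [← abs_of_nonneg hn, absσ, hpow, hpow, abs_mul]
    have h3 : |-2 * sin ((t - α) / 2) * sin ((t - β) / 2)| =
        2 * |sin ((t - α) / 2) * sin ((t - β) / 2)| := by
      rw [mul_assoc, abs_mul]; norm_num
    rw [h3]
    have hA : 0 ≤ (1 - sin ((t - α) / 2) ^ 2) ^ 5 :=
      pow_nonneg (by linarith [sin_sq_le_one ((t - α) / 2)]) _
    have hB : 0 ≤ (1 - sin ((t - β) / 2) ^ 2) ^ 5 :=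
      pow_nonneg (by linarith [sin_sq_le_one ((t - β) / 2)]) _
    set A := (1 - sin ((t - α) / 2) ^ 2) ^ 5
    set B := (1 - sin ((t - β) / 2) ^ 2) ^ 5
    set Y := |sin ((t - α) / 2) * sin ((t - β) / 2)|
    have hY : 0 ≤ Y := abs_nonneg _
    have q1 := mul_le_mul_of_nonneg_right (hsqabs t) hY
    have q2 := mul_le_mul_of_nonneg_left key (sq_nonneg (u t))
    have q3 := mul_nonneg (sub_nonneg.2 (hle t)) (add_nonneg hA hB)
    nlinarith
  have hB : ∫ t in α..(α + 2 * π), ((1 + cos (t - β)) / 2) ^ 5 = 2 * π * (63 / 256) := by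
    rw [← integral_half_one_add_cos_pow_five β]
    exact Function.Periodic.intervalIntegral_add_eq
      (fun t => by simp only [add_sub_right_comm, cos_add_two_pi]) α β
  rw [integral_const_mul, integral_const_mul, integral_sub (ii (by fun_prop)) (ii (by fun_prop)),
    integral_add (ii (by fun_prop)) (ii (by fun_prop)), integral_half_one_add_cos_pow_five,
    hB, ← hsub] at hmono
  rw [← absσ]
  refine le_trans ?_ (le_abs_self _)
  linarith

end CircleEstimate

/-- First-order mean value formula on circles inside the domain of harmonicity. -/
lemma HarmonicOnNhd.circleAverage_mul_re_eq {U : ℂ → ℝ}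
    (hU : HarmonicOnNhd U (ball (0 : ℂ) 1)) (a : ℂ) {r : ℝ} (hr0 : 0 < r) (hr1 : r < 1) :
    circleAverage (fun z => U z * (z * star a).re) 0 r = r ^ 2 / 2 * fderiv ℝ U 0 a := by
  obtain ⟨g, hg, hgU⟩ := hU.exists_analyticOnNhd_ball_re_eq
  have hsub : closedBall (0 : ℂ) r ⊆ ball 0 1 := closedBall_subset_ball hr1
  have hgd : DifferentiableOn ℂ g (closedBall 0 r) := hg.differentiableOn.mono hsub
  have hder : fderiv ℝ U 0 a = (deriv g 0 * a).re := by
    have h1 : HasDerivAt g (deriv g 0) 0 :=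
      (hg 0 (by simp)).differentiableAt.hasDerivAt
    have h2 := (Complex.reCLM.hasFDerivAt).comp (0 : ℂ)
      (h1.hasFDerivAt.restrictScalars ℝ)
    have h3 : HasFDerivAt U _ 0 := h2.congr_of_eventuallyEq
      (Filter.eventually_of_mem (ball_mem_nhds 0 one_pos) fun z hz => (hgU hz).symm)
    rw [h3.fderiv]
    simp [mul_comm]
  have m1 : circleAverage (fun z => z * g z) 0 r = 0 := by
    have hd : DifferentiableOn ℂ (fun z => z * g z) (closedBall 0 r) :=
      differentiableOn_id.mul hgd
    have : DiffContOnCl ℂ (fun z => z * g z) (ball 0 |r|) := by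
      rw [abs_of_pos hr0]
      exact (hd.mono closure_ball_subset_closedBall).diffContOnCl
    rw [this.circleAverage]
    simp
  have m2 : circleAverage (fun z => z⁻¹ * g z) 0 r = deriv g 0 := by
    rw [circleAverage_eq_circleIntegral hr0.ne']
    have h := hgd.deriv_eq_smul_circleIntegral hr0
    have e : (fun z : ℂ => (z - 0)⁻¹ • (z⁻¹ * g z)) = fun z => (1 / (z - 0) ^ 2) • g z := by
      funext z
      simp only [sub_zero, smul_eq_mul, one_div, sq, mul_inv]
      ring
    rw [e, h, smul_smul, inv_mul_cancel₀ Complex.two_pi_I_ne_zero, one_smul]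
  have hcont : ContinuousOn g (sphere 0 |r|) := by
    rw [abs_of_pos hr0]
    exact hgd.continuousOn.mono sphere_subset_closedBall
  have i1 : CircleIntegrable (fun z => (star a / 2) • (z * g z)) 0 r :=
    ContinuousOn.circleIntegrable' (by fun_prop)
  have i2 : CircleIntegrable (fun z => (r ^ 2 * a / 2 : ℂ) • (z⁻¹ * g z)) 0 r :=
    ContinuousOn.circleIntegrable' (by
      have : ContinuousOn (fun z : ℂ => z⁻¹) (sphere 0 |r|) :=
        continuousOn_id.inv₀ fun z hz h => by
          simp only [id] at h
          subst h
          simp only [mem_sphere_iff_norm, sub_self, norm_zero, abs_of_pos hr0] at hz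
          exact hr0.ne hz
      fun_prop)
  have hEq : EqOn (fun z => U z * (z * star a).re)
      (Complex.reCLM ∘ ((fun z => (star a / 2) • (z * g z)) +
        fun z => (r ^ 2 * a / 2 : ℂ) • (z⁻¹ * g z))) (sphere 0 |r|) := by
    intro z hz
    have hzr : ‖z‖ = r := by simpa [abs_of_pos hr0] using hz
    have hz0 : z ≠ 0 := by rintro rfl; simp at hzr; exact hr0.ne hzr
    have hinv : (r ^ 2 : ℂ) * z⁻¹ = star z := by
      rw [← hzr, ← Complex.mul_conj']
      field_simp
      rfl
    have hUz : U z = (g z).re := (hgU (hsub (sphere_subset_closedBall (by simpa using hzr)))).symm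
    have e2 : (r ^ 2 * a / 2 : ℂ) • (z⁻¹ * g z) = a / 2 * (star z * g z) := by
      rw [← hinv, smul_eq_mul]; ring
    simp only [Function.comp, Pi.add_apply]
    rw [e2, hUz]
    simp
    ring
  rw [circleAverage_congr_sphere hEq, Complex.reCLM.circleAverage_comp_comm (i1.add i2),
    circleAverage_add i1 i2, circleAverage_fun_smul, circleAverage_fun_smul, m1, m2, hder]
  have : (r ^ 2 * a / 2 : ℂ) * deriv g 0 = ((r ^ 2 / 2 : ℝ) : ℂ) * (deriv g 0 * a) := by
    push_cast; ring
  rw [smul_zero, zero_add, smul_eq_mul, this]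
  simp only [Complex.reCLM_apply, Complex.re_ofReal_mul]

/-- First-order mean value formula for harmonic functions continuous up to the boundary. -/
lemma HarmonicContOnCl.circleAverage_mul_re_eq {U : ℂ → ℝ}
    (hU : HarmonicContOnCl U (ball (0 : ℂ) 1)) (a : ℂ) :
    circleAverage (fun z => U z * (z * star a).re) 0 1 = 1 / 2 * fderiv ℝ U 0 a := by
  have H : ContinuousOn (circleAverage (fun z => U z * (z * star a).re) 0) (Ioc 0 1) := by
    have hc := hU.continuousOn_ball
    refine ContinuousOn.circleAverage (f := fun z => U z * (z * star a).re) ?_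
      (fun z hz => hz.1.le)
    refine ContinuousOn.mono (s := closedBall 0 1) ?_ ?_
    · exact hc.mul (Complex.continuous_re.comp (by fun_prop)).continuousOn
    · intro x hx
      rw [mem_closedBall_iff_norm]
      exact hx.2
  have H2 : ContinuousOn (fun r : ℝ => r ^ 2 / 2 * fderiv ℝ U 0 a) (Ioc 0 1) := by fun_prop
  have := (H.sub H2).eq_of_eqOn_Ioo (c := 0) one_pos fun r hr => sub_eq_zero.2 <|
    HarmonicOnNhd.circleAverage_mul_re_eq hU.1 a hr.1 hr.2
  simpa [sub_eq_zero] using this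

lemma isOpen_unitB : IsOpen unitB :=
  isOpen_lt (f := fun p : ℝ × ℝ => p.1 ^ 2 + p.2 ^ 2) (by fun_prop) continuous_const

lemma preimage_unitB : Complex.equivRealProdCLM ⁻¹' unitB = ball (0 : ℂ) 1 := by
  ext z
  rw [mem_ball_zero_iff, ← sq_lt_one_iff₀ (norm_nonneg z), Complex.sq_norm, Complex.normSq_apply]
  simp [unitB, sq]

lemma harmonicContOnCl_comp_equivRealProdCLM {E : Type*} [NormedAddCommGroup E] [NormedSpace ℝ E]
    {X : ℝ × ℝ → E} (hX : ContDiffOn ℝ 2 X unitB) (hc : ContinuousOn X (closure unitB))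
    (hh : ∀ p ∈ unitB, pd1 (pd1 X) p + pd2 (pd2 X) p = 0) :
    HarmonicContOnCl (X ∘ Complex.equivRealProdCLM) (ball (0 : ℂ) 1) := by
  set e := Complex.equivRealProdCLM with he
  have hCD : ∀ z ∈ ball (0 : ℂ) 1, ContDiffAt ℝ 2 (X ∘ e) z := fun z hz => by
    rw [← preimage_unitB] at hz
    exact (hX.contDiffAt (isOpen_unitB.mem_nhds hz)).comp z e.contDiff.contDiffAt
  have second : ∀ z ∈ ball (0 : ℂ) 1, ∀ a : ℂ, iteratedFDeriv ℝ 2 (X ∘ e) z ![a, a] =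
      fderiv ℝ (fun p => fderiv ℝ X p (e a)) (e z) (e a) := fun z hz a => by
    have hd : DifferentiableAt ℝ (fderiv ℝ (X ∘ e)) z :=
      ((hCD z hz).fderiv_right (m := 1) (by norm_num)).differentiableAt one_ne_zero
    have h1 : fderiv ℝ (fderiv ℝ (X ∘ e)) z a a =
        fderiv ℝ (fun w => fderiv ℝ (X ∘ e) w a) z a := by
      rw [fderiv_clm_apply hd (by fun_prop)]
      simp
    have h2 : (fun w => fderiv ℝ (X ∘ e) w a) = (fun p => fderiv ℝ X p (e a)) ∘ e := by
      funext w
      rw [e.comp_right_fderiv]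
      rfl
    rw [iteratedFDeriv_two_apply]
    simp only [Matrix.cons_val_zero, Matrix.cons_val_one]
    rw [h1, h2, e.comp_right_fderiv]
    rfl
  refine HarmonicContOnCl.mk_ball (fun z hz => ⟨hCD z hz, ?_⟩) ?_
  · filter_upwards [isOpen_ball.mem_nhds hz] with w hw
    rw [laplacian_eq_iteratedFDeriv_complexPlane]
    simp only [second w hw]
    rw [← preimage_unitB] at hw
    have := hh _ hw
    have e1 : e 1 = (1, 0) := by simp [he]
    have e2 : e Complex.I = (0, 1) := by simp [he]
    rw [e1, e2]
    exact this
  · refine hc.comp e.continuous.continuousOn ?_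
    rw [← closure_ball (0 : ℂ) one_ne_zero, ← preimage_unitB]
    exact fun z hz => e.continuous.closure_preimage_subset _ hz

/-- Two distinct points of the unit circle, in angular coordinates within one period. -/
lemma exists_circleMap_eq_of_ne {P Q : ℂ} (hP : P ∈ sphere (0 : ℂ) 1) (hQ : Q ∈ sphere (0 : ℂ) 1)
    (hPQ : P ≠ Q) : ∃ α β : ℝ, α < β ∧ β < α + 2 * π ∧ circleMap 0 1 α = P ∧
      circleMap 0 1 β = Q := by
  have hrep (z : ℂ) (hz : z ∈ sphere (0 : ℂ) 1) : ∃ t, circleMap 0 1 t = z := by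
    rw [← abs_one (α := ℝ), ← range_circleMap] at hz
    exact hz
  obtain ⟨α, hα⟩ := hrep P hP
  obtain ⟨γ, hγ⟩ := hrep Q hQ
  have hmem := toIcoMod_mem_Ico two_pi_pos α γ
  have hβ : circleMap 0 1 (toIcoMod two_pi_pos α γ) = Q := by
    rw [← hγ]
    exact (periodic_circleMap 0 1).sub_zsmul_eq (toIcoDiv two_pi_pos α γ)
  refine ⟨α, _, lt_of_le_of_ne hmem.1 fun h => hPQ ?_, hmem.2, hα, hβ⟩
  rw [← hα, ← hβ, ← h]

/-- Gradient bound at the origin for a harmonic function on the disc whose boundary values vanish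
at exactly two points and are large in mean square. -/
lemma exists_le_abs_fderiv_of_two_zeros {U : ℂ → ℝ} {R : ℝ} (hR : 0 < R)
    (hU : HarmonicContOnCl U (ball (0 : ℂ) 1)) (h0 : U 0 = 0)
    (hle : ∀ z ∈ sphere (0 : ℂ) 1, U z ^ 2 ≤ R ^ 2) {P Q : ℂ} (hP : P ∈ sphere (0 : ℂ) 1)
    (hQ : Q ∈ sphere (0 : ℂ) 1) (hPQ : P ≠ Q) (hUQ : U Q = 0)
    (hzero : ∀ z ∈ sphere (0 : ℂ) 1, U z = 0 → z = P ∨ z = Q)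
    (hsq : π * R ^ 2 ≤ ∫ t in 0..(2 * π), U (circleMap 0 1 t) ^ 2) :
    ∃ a : ℂ, ‖a‖ = 1 ∧ R / 800 ≤ |fderiv ℝ U 0 a| := by
  have hpi := pi_pos
  have hmem (t : ℝ) : circleMap 0 1 t ∈ sphere (0 : ℂ) 1 := circleMap_mem_sphere 0 zero_le_one t
  obtain ⟨α, β, hαβ, hβ, rfl, rfl⟩ := exists_circleMap_eq_of_ne hP hQ hPQ
  have hcont : Continuous fun t => U (circleMap 0 1 t) :=
    hU.continuousOn_ball.comp_continuous (continuous_circleMap 0 1)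
      fun t => sphere_subset_closedBall (hmem t)
  have hmean : ∫ t in 0..(2 * π), U (circleMap 0 1 t) = 0 := by
    have h := InnerProductSpace.HarmonicContOnCl.circleAverage_eq (f := U) (c := 0) (R := 1) (by simpa using hU)
    rw [h0, circleAverage_def, smul_eq_mul] at h
    exact (mul_eq_zero.1 h).resolve_left (by positivity)
  have hinj : ∀ t ∈ Ioo α (α + 2 * π), circleMap 0 1 t = circleMap 0 1 β → t = β := by
    intro t ht h
    refine injOn_circleMap_of_abs_sub_le one_ne_zero (a := α) (b := α + 2 * π) ?_ ?_ ?_ h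
    · rw [sub_add_cancel_left, abs_neg, abs_of_pos two_pi_pos]
    · rw [uIoc_of_le (by linarith)]; exact ⟨ht.1, ht.2.le⟩
    · rw [uIoc_of_le (by linarith)]; exact ⟨hαβ, hβ.le⟩
  have hinj' : ∀ t ∈ Ioo α (α + 2 * π), circleMap 0 1 t ≠ circleMap 0 1 α := by
    intro t ht h
    rw [← periodic_circleMap 0 1 α] at h
    have := injOn_circleMap_of_abs_sub_le one_ne_zero (a := α) (b := α + 2 * π)
      (by rw [sub_add_cancel_left, abs_neg, abs_of_pos two_pi_pos])
      (by rw [uIoc_of_le (by linarith)]; exact ⟨ht.1, ht.2.le⟩)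
      (by rw [uIoc_of_le (by linarith)]; exact ⟨by linarith, le_rfl⟩) h
    exact ht.2.ne this
  obtain ⟨m, hm⟩ := exists_le_abs_integral_mul_cos (u := fun t => U (circleMap 0 1 t) / R)
    (hcont.div_const R) (fun t => by simp only [periodic_circleMap 0 1 t]) hαβ hβ
    (by simp [hUQ])
    (fun t ht h => by
      rcases hzero _ (hmem t) ((div_eq_zero_iff.1 h).resolve_right hR.ne') with h | h
      · exact absurd h (hinj' t ht)
      · exact hinj t ht h)
    (fun t => by
      rw [div_pow, div_le_one (by positivity)]
      exact hle _ (hmem t))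
    (by rw [intervalIntegral.integral_div, hmean, zero_div])
    (by
      simp only [div_pow]
      rw [intervalIntegral.integral_div, le_div_iff₀ (by positivity)]
      exact hsq)
  refine ⟨circleMap 0 1 m, by simp, ?_⟩
  have h := HarmonicContOnCl.circleAverage_mul_re_eq hU (circleMap 0 1 m)
  have hcos (t : ℝ) : (circleMap 0 1 t * star (circleMap 0 1 m)).re = cos (t - m) := by
    simp [circleMap_zero, Complex.exp_ofReal_mul_I_re, Complex.exp_ofReal_mul_I_im, cos_sub]
  rw [circleAverage_def, smul_eq_mul] at h
  simp only [hcos] at h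
  simp only [div_mul_eq_mul_div] at hm
  rw [intervalIntegral.integral_div, abs_div, abs_of_pos hR, le_div_iff₀ hR] at hm
  have h' : fderiv ℝ U 0 (circleMap 0 1 m) =
      π⁻¹ * ∫ t in 0..(2 * π), U (circleMap 0 1 t) * cos (t - m) := by
    field_simp at h ⊢
    linarith
  rw [h', abs_mul, abs_of_pos (inv_pos.2 hpi), inv_mul_eq_div, le_div_iff₀ hpi]
  linarith

/-- Gradient bound at the origin for a component of a harmonic map of the unit disc that restricts
to a bijection of the unit circle onto the circle of radius `R`. -/
lemma exists_le_abs_fderiv_of_bijOn_circle {U V : ℂ → ℝ} {R : ℝ} (hR : 0 < R)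
    (hU : HarmonicContOnCl U (ball (0 : ℂ) 1)) (h0 : U 0 = 0)
    (hcirc : ∀ z ∈ sphere (0 : ℂ) 1, U z ^ 2 + V z ^ 2 = R ^ 2)
    (hinj : ∀ z ∈ sphere (0 : ℂ) 1, ∀ w ∈ sphere (0 : ℂ) 1, U z = U w → V z = V w → z = w)
    (hsurj : ∀ x y : ℝ, x ^ 2 + y ^ 2 = R ^ 2 → ∃ z ∈ sphere (0 : ℂ) 1, U z = x ∧ V z = y)
    (hsq : π * R ^ 2 ≤ ∫ t in 0..(2 * π), U (circleMap 0 1 t) ^ 2) :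
    ∃ a : ℂ, ‖a‖ = 1 ∧ R / 800 ≤ |fderiv ℝ U 0 a| := by
  obtain ⟨P, hP, hUP, hVP⟩ := hsurj 0 R (by ring)
  obtain ⟨Q, hQ, hUQ, hVQ⟩ := hsurj 0 (-R) (by ring)
  refine exists_le_abs_fderiv_of_two_zeros hR hU h0
    (fun z hz => by linarith [hcirc z hz, sq_nonneg (V z)]) hP hQ ?_ hUQ ?_ hsq
  · rintro rfl
    linarith
  · intro z hz hUz
    have h := hcirc z hz
    rw [hUz, zero_pow two_ne_zero, zero_add] at h
    rcases sq_eq_sq_iff_eq_or_eq_neg.1 h with h | h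
    · exact Or.inl (hinj z hz P hP (hUz.trans hUP.symm) (h.trans hVP.symm))
    · exact Or.inr (hinj z hz Q hQ (hUz.trans hUQ.symm) (h.trans hVQ.symm))

/-- Both partial derivatives control the derivatives of a component in unit directions. -/
lemma sq_fderiv_component_le {n : ℕ} {X : ℝ × ℝ → EuclideanSpace ℝ (Fin n)}
    (hX : DifferentiableAt ℝ X (0, 0)) (i : Fin n) {w : ℝ} (h1 : ‖pd1 X (0, 0)‖ ^ 2 = w)
    (h2 : ‖pd2 X (0, 0)‖ ^ 2 = w) {a : ℂ} (ha : ‖a‖ = 1) :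
    (fderiv ℝ (EuclideanSpace.proj (𝕜 := ℝ) i ∘ X ∘ Complex.equivRealProdCLM) 0 a) ^ 2 ≤ 2 * w := by
  have hcomp (v : EuclideanSpace ℝ (Fin n)) : v i ^ 2 ≤ ‖v‖ ^ 2 := by
    rw [← sq_abs]
    gcongr
    exact PiLp.norm_apply_le v i
  have hf : fderiv ℝ (EuclideanSpace.proj (𝕜 := ℝ) i ∘ X ∘ Complex.equivRealProdCLM) 0 a =
      a.re * pd1 X (0, 0) i + a.im * pd2 X (0, 0) i := by
    have hX' : HasFDerivAt X (fderiv ℝ X (0, 0)) (Complex.equivRealProdCLM 0) := by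
      simpa using hX.hasFDerivAt
    have h := (EuclideanSpace.proj (𝕜 := ℝ) i).hasFDerivAt.comp (0 : ℂ)
      (hX'.comp (0 : ℂ) Complex.equivRealProdCLM.hasFDerivAt)
    have hsplit : Complex.equivRealProdCLM a = a.re • ((1, 0) : ℝ × ℝ) + a.im • (0, 1) := by
      simp
    rw [h.fderiv]
    simp only [ContinuousLinearMap.comp_apply, ContinuousLinearEquiv.coe_coe, hsplit, map_add,
      map_smul]
    rfl
  have ha' : a.re ^ 2 + a.im ^ 2 = 1 := by
    have := Complex.sq_norm a
    rw [ha, Complex.normSq_apply] at this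
    linarith
  have q1 := hcomp (pd1 X (0, 0))
  have q2 := hcomp (pd2 X (0, 0))
  rw [hf]
  nlinarith [sq_nonneg (a.re * pd2 X (0, 0) i - a.im * pd1 X (0, 0) i)]

/-- Lower bound for the area element at the origin, based on E. Heinz's 1952
gradient estimate for univalent harmonic mappings: there is a universal
constant `c > 0` such that for every conformally parametrized harmonic map `X`
whose first two components map `B̄` one-to-one onto `B̄_R` with positive
Jacobian, fixing the origin and mapping the boundary topologically, one has
`W(0,0) ≥ c·R²`. -/
theorem area_element_lower_bound :
    ∃ c : ℝ, 0 < c ∧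
      ∀ (n : ℕ), 3 ≤ n →
      ∀ (R : ℝ), 0 < R →
      ∀ (X : ℝ × ℝ → EuclideanSpace ℝ (Fin n)) (W : ℝ × ℝ → ℝ),
        ContDiffOn ℝ 2 X unitB →
        ContinuousOn X (closure unitB) →
        -- `X` is harmonic in `B`
        (∀ p ∈ unitB, pd1 (pd1 X) p + pd2 (pd2 X) p = 0) →
        -- conformality relations
        (∀ p ∈ unitB,
          ‖pd1 X p‖ ^ 2 = W p ∧ ‖pd2 X p‖ ^ 2 = W p ∧
          ⟪pd1 X p, pd2 X p⟫ = 0 ∧ 0 < W p) →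
        -- the plane mapping `F* = (x¹, x²)` maps `B̄` one-to-one onto `B̄_R` ...
        ∀ hn' : 3 ≤ n,
        (Set.BijOn (fun p => (X p ⟨0, by omega⟩, X p ⟨1, by omega⟩))
          (closure unitB) (closure (diskR R))) →
        -- ... with positive Jacobian in `B` ...
        (∀ p ∈ unitB,
          pd1 (fun q => X q (⟨0, by omega⟩ : Fin n)) p *
            pd2 (fun q => X q (⟨1, by omega⟩ : Fin n)) p -
          pd1 (fun q => X q (⟨1, by omega⟩ : Fin n)) p *
            pd2 (fun q => X q (⟨0, by omega⟩ : Fin n)) p > 0) →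
        -- ... it satisfies `F*(0,0) = (0,0)` ...
        (X (0, 0) (⟨0, by omega⟩ : Fin n) = 0 ∧
         X (0, 0) (⟨1, by omega⟩ : Fin n) = 0) →
        -- ... and maps `∂B` topologically onto `∂B_R`
        (Set.BijOn (fun p => (X p ⟨0, by omega⟩, X p ⟨1, by omega⟩))
          (circleR 1) (circleR R)) →
        -- then the area element at the origin satisfies `W(0,0) ≥ c·R²`
        c * R ^ 2 ≤ W (0, 0) := by

  refine ⟨1 / 1280000, by norm_num, ?_⟩
  intro n _ R hR X W hX hc hh hconf hn' _ _ h0 hbij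
  set i0 : Fin n := ⟨0, by omega⟩
  set i1 : Fin n := ⟨1, by omega⟩
  have hmem0 : ((0, 0) : ℝ × ℝ) ∈ unitB := by simp [unitB]
  have hdiff : DifferentiableAt ℝ X (0, 0) :=
    (hX.contDiffAt (isOpen_unitB.mem_nhds hmem0)).differentiableAt two_ne_zero
  obtain ⟨hW1, hW2, -, -⟩ := hconf _ hmem0
  set e := Complex.equivRealProdCLM with he
  have hsph (z : ℂ) : z ∈ sphere (0 : ℂ) 1 ↔ e z ∈ circleR 1 := by
    rw [mem_sphere_zero_iff_norm, ← sq_eq_sq₀ (norm_nonneg z) zero_le_one, Complex.sq_norm,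
      Complex.normSq_apply]
    simp [circleR, he, sq]
  have hharm := harmonicContOnCl_comp_equivRealProdCLM hX hc hh
  have harm (i : Fin n) :
      HarmonicContOnCl (EuclideanSpace.proj (𝕜 := ℝ) i ∘ X ∘ e) (ball (0 : ℂ) 1) :=
    hharm.comp_CLM _
  have hcirc : ∀ z ∈ sphere (0 : ℂ) 1, X (e z) i0 ^ 2 + X (e z) i1 ^ 2 = R ^ 2 :=
    fun z hz => hbij.mapsTo ((hsph z).1 hz)
  have hinj : ∀ z ∈ sphere (0 : ℂ) 1, ∀ w ∈ sphere (0 : ℂ) 1,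
      X (e z) i0 = X (e w) i0 → X (e z) i1 = X (e w) i1 → z = w :=
    fun z hz w hw h1 h2 => e.injective
      (hbij.injOn ((hsph z).1 hz) ((hsph w).1 hw) (Prod.ext h1 h2))
  have hsurj : ∀ x y : ℝ, x ^ 2 + y ^ 2 = R ^ 2 →
      ∃ z ∈ sphere (0 : ℂ) 1, X (e z) i0 = x ∧ X (e z) i1 = y := by
    intro x y hxy
    obtain ⟨p, hp, hpe⟩ := hbij.surjOn (show (x, y) ∈ circleR R from hxy)
    refine ⟨e.symm p, (hsph _).2 (by simpa using hp), ?_⟩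
    rw [e.apply_symm_apply]
    exact Prod.ext_iff.1 hpe
  have finish (i : Fin n) (h : ∃ a : ℂ, ‖a‖ = 1 ∧
      R / 800 ≤ |fderiv ℝ (EuclideanSpace.proj (𝕜 := ℝ) i ∘ X ∘ e) 0 a|) :
      1 / 1280000 * R ^ 2 ≤ W (0, 0) := by
    obtain ⟨a, ha, hle⟩ := h
    have h1 := sq_fderiv_component_le hdiff i hW1 hW2 ha
    have h2 := pow_le_pow_left₀ (by positivity) hle 2
    rw [sq_abs] at h2
    linarith
  have hint (i : Fin n) : IntervalIntegrable (fun t => X (e (circleMap 0 1 t)) i ^ 2)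
      MeasureTheory.volume 0 (2 * π) :=
    (((harm i).continuousOn_ball.comp_continuous (continuous_circleMap 0 1) fun t =>
      sphere_subset_closedBall (circleMap_mem_sphere 0 zero_le_one t)).pow 2).intervalIntegrable _ _
  have hsum : (∫ t in 0..(2 * π), X (e (circleMap 0 1 t)) i0 ^ 2) +
      ∫ t in 0..(2 * π), X (e (circleMap 0 1 t)) i1 ^ 2 = 2 * π * R ^ 2 := by
    rw [← intervalIntegral.integral_add (hint i0) (hint i1)]
    simp only [hcirc _ (circleMap_mem_sphere 0 zero_le_one _)]
    simp
  have e0 : e 0 = (0, 0) := map_zero e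
  rcases le_total (π * R ^ 2) (∫ t in 0..(2 * π), X (e (circleMap 0 1 t)) i0 ^ 2) with h | h
  · exact finish i0 (exists_le_abs_fderiv_of_bijOn_circle (V := fun z => X (e z) i1) hR (harm i0)
      (show X (e 0) i0 = 0 by rw [e0]; exact h0.1) hcirc hinj hsurj h)
  · refine finish i1 (exists_le_abs_fderiv_of_bijOn_circle (V := fun z => X (e z) i0) hR (harm i1)
      (show X (e 0) i1 = 0 by rw [e0]; exact h0.2)
      (fun z hz => (add_comm _ _).trans (hcirc z hz))
      (fun z hz w hw h1 h2 => hinj z hz w hw h2 h1) (fun x y hxy => ?_)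
      (show π * R ^ 2 ≤ ∫ t in 0..(2 * π), X (e (circleMap 0 1 t)) i1 ^ 2 by linarith))
    obtain ⟨z, hz, h1, h2⟩ := hsurj y x ((add_comm _ _).trans hxy)
    exact ⟨z, hz, h2, h1⟩
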